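/- Let d ≥ 1 and n ≥ 1 be integers, ω = exp(2πi/d), and consider complex matrices indexed by functions f : Fin n → ZMod d. For 1 ≤ i ≤ n define Z_i by (Z_i)_{f,g} = ω^{f(i)} if f = g and 0 otherwise, and X_i by (X_i)_{f,g} = 1 if f(i) = g(i)+1 and f(j) = g(j) for all j ≠ i, and 0 otherwise. Define γ_{2i−1} = (∏_{j<i} X_j)·Z_i and γ_{2i} = exp(πi(d+1)/d)·(∏_{j≤i} X_j)·Z_i for 1 ≤ i ≤ n. Then the 2n matrices γ_1, …, γ_{2n} are unitary and satisfy the parafermion relations: γ_a^d = 1 for every a, and γ_a·γ_b = ω·γ_b·γ_a whenever 1 ≤ a < b ≤ 2n. -/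

import Mathlib

open Complex Matrix

variable (d n : ℕ) [NeZero d]

/-- ω = exp(2πi/d). -/
noncomputable def omegaC : ℂ := Complex.exp (2 * Real.pi * Complex.I / d)

/-- The generalized Pauli `Z` operator on the `i`-th qudit:
`(Z_i)_{f,g} = ω^{f(i)} δ_{f,g}`. -/
noncomputable def Zop (i : Fin n) : Matrix (Fin n → ZMod d) (Fin n → ZMod d) ℂ :=
  fun f g => if f = g then omegaC d ^ (f i).val else 0

/-- The generalized Pauli `X` operator on the `i`-th qudit:
`(X_i)_{f,g} = 1` if `f i = g i + 1` and `f j = g j` for `j ≠ i`, else `0`. -/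
def Xop (i : Fin n) : Matrix (Fin n → ZMod d) (Fin n → ZMod d) ℂ :=
  fun f g => if f i = g i + 1 ∧ ∀ j, j ≠ i → f j = g j then 1 else 0

/-- The ordered product `∏_{j < i} X_j` (a string of `X` operators). -/
noncomputable def XprodLT (i : Fin n) : Matrix (Fin n → ZMod d) (Fin n → ZMod d) ℂ :=
  (((List.finRange n).filter (fun j => j < i)).map (Xop d n)).prod

/-- The ordered product `∏_{j ≤ i} X_j`. -/
noncomputable def XprodLE (i : Fin n) : Matrix (Fin n → ZMod d) (Fin n → ZMod d) ℂ :=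
  (((List.finRange n).filter (fun j => j ≤ i)).map (Xop d n)).prod

/-- The Jordan–Wigner parafermion operators, one-indexed: for `1 ≤ i ≤ n`,
`γ_{2i-1} = (∏_{j<i} X_j)·Z_i` and `γ_{2i} = e^{πi(d+1)/d}·(∏_{j≤i} X_j)·Z_i`,
where qudit `i` corresponds to the zero-based index `(a-1)/2` for `a ∈ {2i-1, 2i}`. -/
noncomputable def gammaJW (a : ℕ) : Matrix (Fin n → ZMod d) (Fin n → ZMod d) ℂ :=
  if h : (a - 1) / 2 < n then
    if a % 2 = 1 then XprodLT d n ⟨(a - 1) / 2, h⟩ * Zop d n ⟨(a - 1) / 2, h⟩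
    else Complex.exp (Real.pi * Complex.I * (d + 1) / d) •
      (XprodLE d n ⟨(a - 1) / 2, h⟩ * Zop d n ⟨(a - 1) / 2, h⟩)
  else 1

/-- Shift by a vector. -/
noncomputable def Sh (v : Fin n → ZMod d) : Matrix (Fin n → ZMod d) (Fin n → ZMod d) ℂ :=
  fun f g => if f = g + v then 1 else 0

lemma Sh_mul (u v : Fin n → ZMod d) : Sh d n u * Sh d n v = Sh d n (u + v) := by
  ext f g
  rw [Matrix.mul_apply, Finset.sum_eq_single (g + v)]
  · simp [Sh, add_assoc, add_comm u v]
  · intro b _ hb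
    simp [Sh, hb]
  · simp

lemma Sh_zero : Sh d n 0 = 1 := by
  ext f g
  simp [Sh, Matrix.one_apply]

lemma Sh_conj (v : Fin n → ZMod d) : (Sh d n v)ᴴ = Sh d n (-v) := by
  ext f g
  simp only [Sh, Matrix.conjTranspose_apply]
  have : g = f + v ↔ f = g + -v := by
    constructor
    · rintro rfl; simp
    · rintro rfl; simp
  by_cases h : g = f + v
  · rw [if_pos h, if_pos (this.1 h)]; simp
  · rw [if_neg h, if_neg (fun k => h (this.2 k))]; simp

lemma Sh_pow (v : Fin n → ZMod d) (m : ℕ) : Sh d n v ^ m = Sh d n (m • v) := by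
  induction m with
  | zero => simp [Sh_zero]
  | succ k ih => rw [pow_succ, ih, Sh_mul, succ_nsmul]

lemma Sh_pow_d (v : Fin n → ZMod d) : Sh d n v ^ d = 1 := by
  rw [Sh_pow, ← Sh_zero]
  congr 1
  ext k
  simp

lemma Xop_eq (i : Fin n) : Xop d n i = Sh d n (Pi.single i 1) := by
  ext f g
  have : (f i = g i + 1 ∧ ∀ j, j ≠ i → f j = g j) ↔ f = g + Pi.single i 1 := by
    constructor
    · rintro ⟨h1, h2⟩
      ext j
      by_cases hj : j = i
      · subst hj; simp [h1]
      · simp [hj, h2 j hj]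
    · rintro rfl
      refine ⟨by simp, fun j hj => by simp [hj]⟩
  simp only [Xop, Sh, this]

lemma Xlist (l : List (Fin n)) :
    (l.map (Xop d n)).prod = Sh d n (l.map (fun i => Pi.single i 1)).sum := by
  induction l with
  | nil => simp [Sh_zero]
  | cons a t ih => simp [ih, Xop_eq, Sh_mul]

lemma sumvec (p : Fin n → Bool) (k : Fin n) :
    ((((List.finRange n).filter p).map
      (fun i => (Pi.single i 1 : Fin n → ZMod d))).sum) k = if p k then 1 else 0 := by
  rw [← List.sum_toFinset _ ((List.nodup_finRange n).filter _), Finset.sum_apply]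
  simp [Pi.single_apply]

lemma omega_pow : omegaC d ^ d = 1 := by
  have hd : (d : ℂ) ≠ 0 := Nat.cast_ne_zero.2 (NeZero.ne d)
  rw [omegaC, ← Complex.exp_nat_mul, mul_div_cancel₀ _ hd, Complex.exp_two_pi_mul_I]

lemma omega_pow_mod (m : ℕ) : omegaC d ^ (m % d) = omegaC d ^ m := by
  conv_rhs => rw [← Nat.mod_add_div m d, pow_add, pow_mul, omega_pow, one_pow, mul_one]

lemma star_mul_exp (z : ℂ) (h : z.re = 0) : star (Complex.exp z) * Complex.exp z = 1 := by
  have h1 : star (Complex.exp z) = Complex.exp (star z) := by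
    simp [← Complex.exp_conj]
  rw [h1, ← Complex.exp_add]
  have : star z + z = 0 := by
    apply Complex.ext <;> simp [h]
  rw [this, Complex.exp_zero]

lemma omega_star : star (omegaC d) * omegaC d = 1 := by
  apply star_mul_exp
  have : (2 * Real.pi * Complex.I / d : ℂ) = ((2 * Real.pi / d : ℝ) : ℂ) * Complex.I := by
    push_cast; ring
  rw [this]; simp

lemma c_star : star (Complex.exp (Real.pi * Complex.I * (d + 1) / d)) *
    Complex.exp (Real.pi * Complex.I * (d + 1) / d) = 1 := by
  apply star_mul_exp
  have : (Real.pi * Complex.I * (d + 1) / d : ℂ)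
      = ((Real.pi * (d + 1) / d : ℝ) : ℂ) * Complex.I := by
    push_cast; ring
  rw [this, Complex.re_ofReal_mul]; simp

lemma c_pow : Complex.exp (Real.pi * Complex.I * (d + 1) / d) ^ d *
    omegaC d ^ (d.choose 2) = 1 := by
  have hd : (d : ℂ) ≠ 0 := Nat.cast_ne_zero.2 (NeZero.ne d)
  rw [omegaC, ← Complex.exp_nat_mul, ← Complex.exp_nat_mul, ← Complex.exp_add,
    Nat.cast_choose_two, Complex.exp_eq_one_iff]
  refine ⟨d, ?_⟩
  push_cast
  field_simp
  ring

/-- the character -/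
noncomputable def chi (x : ZMod d) : ℂ := omegaC d ^ x.val

lemma chi_add (x y : ZMod d) : chi d (x + y) = chi d x * chi d y := by
  rw [chi, ZMod.val_add, omega_pow_mod, pow_add]; rfl

lemma chi_zero : chi d 0 = 1 := by simp [chi]

lemma chi_one : chi d 1 = omegaC d := by
  rw [chi, ZMod.val_one_eq_one_mod, omega_pow_mod, pow_one]

lemma Zop_eq (i : Fin n) : Zop d n i = Matrix.diagonal (fun f => chi d (f i)) := by
  ext f g
  simp [Zop, Matrix.diagonal_apply, chi]

lemma Z_comm (i j : Fin n) : Zop d n i * Zop d n j = Zop d n j * Zop d n i := by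
  simp [Zop_eq, Matrix.diagonal_mul_diagonal, mul_comm]

lemma Z_pow (i : Fin n) : Zop d n i ^ d = 1 := by
  rw [Zop_eq, Matrix.diagonal_pow, ← Matrix.diagonal_one]
  congr 1
  ext f
  simp only [Pi.pow_apply, chi]
  rw [← pow_mul, mul_comm, pow_mul, omega_pow, one_pow]

lemma Z_star (i : Fin n) : (Zop d n i)ᴴ * Zop d n i = 1 := by
  rw [Zop_eq, Matrix.diagonal_conjTranspose, Matrix.diagonal_mul_diagonal, ← Matrix.diagonal_one]
  congr 1
  ext f
  simp only [Pi.star_apply, chi]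
  rw [star_pow, ← mul_pow, omega_star, one_pow]

lemma Z_Sh (i : Fin n) (v : Fin n → ZMod d) :
    Zop d n i * Sh d n v = chi d (v i) • (Sh d n v * Zop d n i) := by
  ext f g
  rw [Zop_eq, Matrix.diagonal_mul, Matrix.smul_apply, Matrix.mul_diagonal]
  by_cases h : f = g + v
  · subst h
    simp [Sh, chi_add, mul_comm]
  · simp [Sh, h]

lemma Zpow_S {R : Type*} [Ring R] [Algebra ℂ R] (S Z : R) (q : ℂ) (h : Z * S = q • (S * Z))
    (m : ℕ) : Z ^ m * S = q ^ m • (S * Z ^ m) := by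
  induction m with
  | zero => simp
  | succ k ih =>
    rw [pow_succ, mul_assoc, h, mul_smul_comm, ← mul_assoc, ih, smul_mul_assoc, smul_smul,
      mul_assoc, pow_succ' q]

lemma SZ_pow {R : Type*} [Ring R] [Algebra ℂ R] (S Z : R) (q : ℂ) (h : Z * S = q • (S * Z))
    (m : ℕ) : (S * Z) ^ m = q ^ (m.choose 2) • (S ^ m * Z ^ m) := by
  induction m with
  | zero => simp
  | succ k ih =>
    rw [pow_succ, ih, smul_mul_assoc, mul_assoc, ← mul_assoc (Z ^ k), Zpow_S S Z q h,
      smul_mul_assoc, mul_smul_comm, smul_smul, Nat.choose_succ_succ' k 1, Nat.choose_one_right,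
      add_comm k, pow_add, pow_succ S, pow_succ Z]
    simp only [mul_assoc]

lemma gamma_form (a : ℕ) (h : (a - 1) / 2 < n) :
    ∃ (c : ℂ) (v : Fin n → ZMod d),
      gammaJW d n a = c • (Sh d n v * Zop d n ⟨(a - 1) / 2, h⟩) ∧ star c * c = 1 ∧
      c ^ d * chi d (v ⟨(a - 1) / 2, h⟩) ^ (d.choose 2) = 1 ∧
      (∀ k : Fin n, (k : ℕ) < (a - 1) / 2 → v k = 1) ∧
      (∀ k : Fin n, (a - 1) / 2 < (k : ℕ) → v k = 0) ∧
      v ⟨(a - 1) / 2, h⟩ = if a % 2 = 1 then 0 else 1 := by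
  by_cases ha : a % 2 = 1
  · refine ⟨1, (((List.finRange n).filter (fun j => j < (⟨(a - 1) / 2, h⟩ : Fin n))).map
      (fun i => (Pi.single i 1 : Fin n → ZMod d))).sum, ?_, by simp, ?_, ?_, ?_, ?_⟩
    · rw [gammaJW, dif_pos h, if_pos ha, XprodLT, Xlist, one_smul]
    · rw [sumvec]; simp [chi_zero]
    · intro k hk; rw [sumvec]; simp [Fin.lt_def, hk]
    · intro k hk; rw [sumvec]; simp [Fin.le_def, hk.le]
    · rw [sumvec]; simp [ha]
  · refine ⟨_, (((List.finRange n).filter (fun j => j ≤ (⟨(a - 1) / 2, h⟩ : Fin n))).map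
      (fun i => (Pi.single i 1 : Fin n → ZMod d))).sum, ?_, c_star d, ?_, ?_, ?_, ?_⟩
    · rw [gammaJW, dif_pos h, if_neg ha, XprodLE, Xlist]
    · rw [sumvec]; simp [chi_one, c_pow]
    · intro k hk; rw [sumvec]; simp [Fin.le_def, hk.le]
    · intro k hk; rw [sumvec]; simp [Fin.lt_def, hk]
    · rw [sumvec]; simp [ha]

/-- for `d, n ≥ 1`, the `2n` Jordan–Wigner matrices `γ_1, …, γ_{2n}` are
unitary and satisfy the parafermion relations `γ_a ^ d = 1` and
`γ_a γ_b = ω γ_b γ_a` for `1 ≤ a < b ≤ 2n`. -/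
theorem statement8 (hd : 1 ≤ d) (hn : 1 ≤ n) :
    (∀ a : ℕ, 1 ≤ a → a ≤ 2 * n →
      gammaJW d n a * (gammaJW d n a)ᴴ = 1 ∧ (gammaJW d n a)ᴴ * gammaJW d n a = 1) ∧
    (∀ a : ℕ, 1 ≤ a → a ≤ 2 * n → gammaJW d n a ^ d = 1) ∧
    (∀ a b : ℕ, 1 ≤ a → a < b → b ≤ 2 * n →
      gammaJW d n a * gammaJW d n b = omegaC d • (gammaJW d n b * gammaJW d n a)) := by
  have hlt : ∀ a : ℕ, 1 ≤ a → a ≤ 2 * n → (a - 1) / 2 < n := fun a h1 h2 => by omega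
  refine ⟨?_, ?_, ?_⟩
  · intro a h1 h2
    obtain ⟨c, v, hg, hc, -⟩ := gamma_form d n a (hlt a h1 h2)
    have key : (gammaJW d n a)ᴴ * gammaJW d n a = 1 := by
      rw [hg, Matrix.conjTranspose_smul, Matrix.conjTranspose_mul, smul_mul_smul_comm, hc,
        one_smul, mul_assoc, ← mul_assoc _ (Sh d n v), Sh_conj, Sh_mul, neg_add_cancel, Sh_zero,
        one_mul, Z_star]
    exact ⟨mul_eq_one_comm.1 key, key⟩
  · intro a h1 h2
    obtain ⟨c, v, hg, hc, hp, -⟩ := gamma_form d n a (hlt a h1 h2)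
    rw [hg, smul_pow, SZ_pow _ _ _ (Z_Sh d n _ v), Sh_pow_d, Z_pow, smul_smul, hp]
    simp
  · intro a b h1 hab h2
    have ha := hlt a h1 (by omega)
    have hb := hlt b (by omega) h2
    obtain ⟨c, v, hg, -, -, hv1, hv2, hv3⟩ := gamma_form d n a ha
    obtain ⟨c', w, hg', -, -, hw1, hw2, hw3⟩ := gamma_form d n b hb
    have e1 : w ⟨(a - 1) / 2, ha⟩ = 1 + v ⟨(b - 1) / 2, hb⟩ := by
      rcases (show (a - 1) / 2 ≤ (b - 1) / 2 by omega).lt_or_eq with hl | hl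
      · rw [hw1 _ hl, hv2 _ hl, add_zero]
      · have hi : (⟨(a - 1) / 2, ha⟩ : Fin n) = ⟨(b - 1) / 2, hb⟩ := Fin.ext hl
        rw [hi, hw3, ← hi, hv3, if_neg (by omega), if_pos (by omega), add_zero]
    have L : ∀ (u u' : Fin n → ZMod d) (i j : Fin n),
        Sh d n u * Zop d n i * (Sh d n u' * Zop d n j) =
          chi d (u' i) • (Sh d n (u + u') * (Zop d n i * Zop d n j)) := by
      intro u u' i j
      rw [mul_assoc, ← mul_assoc (Zop d n i), Z_Sh, smul_mul_assoc, mul_smul_comm, ← Sh_mul]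
      simp only [mul_assoc]
    rw [hg, hg', smul_mul_smul_comm, smul_mul_smul_comm, L, L, e1, chi_add, chi_one,
      add_comm w v, Z_comm d n ⟨(b - 1) / 2, hb⟩]
    simp only [smul_smul]
    congr 1
    ring
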